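/- arXiv:0909.0760 — 2 statements merged into one kernel-verified Lean document; each statement's English description precedes it below -/
import Mathlib

section
/- Fix an integer M ≥ 1 and ε > 0. For a cost vector C : Fin M → ℝ, let c* := min over m of C m, let the smooth winner set be Mˢ(C) := {m | C m − c* < ε and c* < 0}, and define the smooth scheduling weights Wˢ(C) : Fin M → ℝ by Wˢ(C) m := (if m ∈ Mˢ(C) then (1 − (C m − c*)/ε)² else 0) / (∑_{m' ∈ Mˢ(C)} (1 − (C m' − c*)/ε)²), with the convention Wˢ(C) m := 0 for all m when Mˢ(C) is empty. Then the map C ↦ Wˢ(C), from (Fin M → ℝ) to (Fin M → ℝ), is continuous at every cost vector C whose minimum entry is nonzero (min_m C m ≠ 0). -/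
/-- The minimum cost `c* = min_m C m`. -/
noncomputable def cmin {M : ℕ} (hM : 1 ≤ M) (C : Fin M → ℝ) : ℝ :=
  Finset.univ.inf' (Finset.univ_nonempty_iff.mpr (Fin.pos_iff_nonempty.mp hM)) C

/-- The smooth winner set `Mˢ(C) = {m | C m − c* < ε ∧ c* < 0}`. -/
noncomputable def winnerSet {M : ℕ} (hM : 1 ≤ M) (ε : ℝ) (C : Fin M → ℝ) :
    Finset (Fin M) :=
  Finset.univ.filter (fun m => C m - cmin hM C < ε ∧ cmin hM C < 0)

/-- The smooth scheduling weights of equation (14). By Lean's convention `x / 0 = 0`,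
when the winner set is empty all weights are zero. -/
noncomputable def Ws {M : ℕ} (hM : 1 ≤ M) (ε : ℝ) (C : Fin M → ℝ) (m : Fin M) : ℝ :=
  (if m ∈ winnerSet hM ε C then (1 - (C m - cmin hM C) / ε) ^ 2 else 0) /
    ∑ m' ∈ winnerSet hM ε C, (1 - (C m' - cmin hM C) / ε) ^ 2

lemma continuous_cmin {M : ℕ} (hM : 1 ≤ M) : Continuous (cmin hM) :=
  Continuous.finset_inf'_apply _ fun m _ => continuous_apply m

lemma exists_eq_cmin {M : ℕ} (hM : 1 ≤ M) (C : Fin M → ℝ) : ∃ m, C m = cmin hM C := by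
  obtain ⟨m, -, hm⟩ := Finset.exists_mem_eq_inf'
    (Finset.univ_nonempty_iff.mpr (Fin.pos_iff_nonempty.mp hM)) C
  exact ⟨m, hm.symm⟩

/-- The unnormalized weight `max(0, 1 − (C m − c*)/ε)²`. -/
noncomputable def clippedWeight {M : ℕ} (hM : 1 ≤ M) (ε : ℝ) (C : Fin M → ℝ) (m : Fin M) : ℝ :=
  max 0 (1 - (C m - cmin hM C) / ε) ^ 2

lemma continuous_clippedWeight {M : ℕ} (hM : 1 ≤ M) (ε : ℝ) (m : Fin M) :
    Continuous fun C => clippedWeight hM ε C m := by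
  have := continuous_cmin hM
  unfold clippedWeight
  fun_prop

lemma sum_clippedWeight_pos {M : ℕ} (hM : 1 ≤ M) (ε : ℝ) (C : Fin M → ℝ) :
    0 < ∑ m, clippedWeight hM ε C m := by
  obtain ⟨m, hm⟩ := exists_eq_cmin hM C
  refine Finset.sum_pos' (fun i _ => sq_nonneg _) ⟨m, Finset.mem_univ m, ?_⟩
  simp [clippedWeight, hm]

lemma ite_mem_winnerSet_eq_clippedWeight {M : ℕ} (hM : 1 ≤ M) {ε : ℝ} (hε : 0 < ε)
    {C : Fin M → ℝ} (hC : cmin hM C < 0) (m : Fin M) :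
    (if m ∈ winnerSet hM ε C then (1 - (C m - cmin hM C) / ε) ^ 2 else 0) =
      clippedWeight hM ε C m := by
  by_cases h : C m - cmin hM C < ε
  · have h₁ : (C m - cmin hM C) / ε < 1 := (div_lt_one hε).2 h
    have h₂ : 0 ≤ 1 - (C m - cmin hM C) / ε := by linarith
    simp [winnerSet, clippedWeight, h, hC, max_eq_right h₂]
  · have h₁ : 1 ≤ (C m - cmin hM C) / ε := (one_le_div hε).2 (not_lt.1 h)
    have h₂ : 1 - (C m - cmin hM C) / ε ≤ 0 := by linarith
    simp [winnerSet, clippedWeight, h, max_eq_left h₂]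

lemma Ws_eq_of_cmin_neg {M : ℕ} (hM : 1 ≤ M) {ε : ℝ} (hε : 0 < ε)
    {C : Fin M → ℝ} (hC : cmin hM C < 0) (m : Fin M) :
    Ws hM ε C m = clippedWeight hM ε C m / ∑ m', clippedWeight hM ε C m' := by
  simp_rw [← ite_mem_winnerSet_eq_clippedWeight hM hε hC]
  rw [Finset.sum_ite_mem, Finset.univ_inter, Ws]

lemma Ws_eq_zero_of_cmin_pos {M : ℕ} (hM : 1 ≤ M) (ε : ℝ)
    {C : Fin M → ℝ} (hC : 0 < cmin hM C) (m : Fin M) : Ws hM ε C m = 0 := by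
  simp [Ws, winnerSet, hC.not_gt]

/-- Proposition 3(iv): the map `C ↦ Wˢ(C)` is continuous at every cost
vector whose minimum entry is nonzero. -/
theorem smooth_scheduler_continuousAt (M : ℕ) (hM : 1 ≤ M) (ε : ℝ) (hε : 0 < ε)
    (C₀ : Fin M → ℝ) (hmin : cmin hM C₀ ≠ 0) :
    ContinuousAt (fun C : Fin M → ℝ => Ws hM ε C) C₀ := by
  refine continuousAt_pi.2 fun m => ?_
  have hcont := (continuous_cmin hM).continuousAt (x := C₀)
  rcases lt_or_gt_of_ne hmin with hneg | hpos
  · have hquot : Continuous fun C =>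
        clippedWeight hM ε C m / ∑ m', clippedWeight hM ε C m' :=
      (continuous_clippedWeight hM ε m).div
        (continuous_finsetSum _ fun m' _ => continuous_clippedWeight hM ε m')
        fun C => (sum_clippedWeight_pos hM ε C).ne'
    refine hquot.continuousAt.congr ?_
    filter_upwards [hcont.eventually_lt_const hneg] with C hC
    exact (Ws_eq_of_cmin_neg hM hε hC m).symm
  · refine (continuousAt_const (y := (0 : ℝ))).congr ?_
    filter_upwards [hcont.eventually_const_lt hpos] with C hC
    exact (Ws_eq_zero_of_cmin_pos hM ε hC m).symm
end

section
/- Let y : ℝ → ℝ be differentiable at every x > 0, with y(x) > 0 for all x > 0, satisfying the differential equation y'(x) = y(x) · (2^x · log 2) / (2^x − 1) for all x > 0. Then y' is differentiable on (0, ∞) with y''(x) = y(x) · 2^x · (log 2)² / (2^x − 1) > 0 for all x > 0; in particular, y is strictly convex on (0, ∞). -/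
/-- A solution on `(0, ∞)` of `y' = y·2^x·log 2/(2^x − 1)` is twice differentiable there. -/
theorem hasDerivAt_deriv_of_power_rate_ode {y : ℝ → ℝ}
    (hdiff : ∀ x : ℝ, 0 < x → DifferentiableAt ℝ y x)
    (hode : ∀ x : ℝ, 0 < x →
      deriv y x = y x * ((2 : ℝ) ^ x * Real.log 2) / ((2 : ℝ) ^ x - 1))
    {x : ℝ} (hx : 0 < x) :
    HasDerivAt (deriv y) (y x * (2 : ℝ) ^ x * (Real.log 2) ^ 2 / ((2 : ℝ) ^ x - 1)) x := by
  have hne : (2 : ℝ) ^ x - 1 ≠ 0 :=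
    (sub_pos.2 (Real.one_lt_rpow one_lt_two hx)).ne'
  have hy : HasDerivAt y _ x := (hdiff x hx).hasDerivAt
  rw [hode x hx] at hy
  have hpow : HasDerivAt (fun t : ℝ => (2 : ℝ) ^ t) ((2 : ℝ) ^ x * Real.log 2) x :=
    Real.hasStrictDerivAt_const_rpow two_pos x |>.hasDerivAt
  have hrhs := (hy.mul (hpow.mul_const (Real.log 2))).div (hpow.sub_const 1) hne
  have heq : deriv y =ᶠ[nhds x]
      fun t => y t * ((2 : ℝ) ^ t * Real.log 2) / ((2 : ℝ) ^ t - 1) := by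
    filter_upwards [Ioi_mem_nhds hx] with t ht using hode t ht
  refine (hrhs.congr_of_eventuallyEq heq).congr_deriv ?_
  simp only [Pi.mul_apply]
  field_simp
  ring

/-- A positive solution on `(0, ∞)` of the ODE
`y' = y·2^x·log 2/(2^x − 1)` has a second derivative there, given by
`y'' = y·2^x·(log 2)²/(2^x − 1) > 0`; in particular `y` is strictly convex on `(0, ∞)`. -/
theorem avg_ber_power_rate_strictConvex (y : ℝ → ℝ)
    (hdiff : ∀ x : ℝ, 0 < x → DifferentiableAt ℝ y x)
    (hpos : ∀ x : ℝ, 0 < x → 0 < y x)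
    (hode : ∀ x : ℝ, 0 < x →
      deriv y x = y x * ((2 : ℝ) ^ x * Real.log 2) / ((2 : ℝ) ^ x - 1)) :
    (∀ x : ℝ, 0 < x → DifferentiableAt ℝ (deriv y) x) ∧
    (∀ x : ℝ, 0 < x →
      deriv (deriv y) x = y x * (2 : ℝ) ^ x * (Real.log 2) ^ 2 / ((2 : ℝ) ^ x - 1) ∧
      0 < deriv (deriv y) x) ∧
    StrictConvexOn ℝ (Set.Ioi (0 : ℝ)) y := by
  have hd2 : ∀ x : ℝ, 0 < x → HasDerivAt (deriv y) _ x := fun x hx =>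
    hasDerivAt_deriv_of_power_rate_ode hdiff hode hx
  have hpos2 : ∀ x : ℝ, 0 < x → 0 < deriv (deriv y) x := by
    intro x hx
    rw [(hd2 x hx).deriv]
    have hden : 0 < (2 : ℝ) ^ x - 1 := sub_pos.2 (Real.one_lt_rpow one_lt_two hx)
    have hy := hpos x hx
    have hlog := Real.log_pos one_lt_two
    positivity
  refine ⟨fun x hx => (hd2 x hx).differentiableAt,
    fun x hx => ⟨(hd2 x hx).deriv, hpos2 x hx⟩, ?_⟩
  refine strictConvexOn_of_deriv2_pos' (convex_Ioi 0)
    (fun x hx => (hdiff x hx).continuousAt.continuousWithinAt) fun x hx => ?_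
  simpa using hpos2 x hx
end
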